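/- Let X and Y be Cantor spaces, f : X → X a chain mixing continuous surjection, and g : Y → Y an aperiodic homeomorphism. Then the following are equivalent: (a) Per(Y,g) ⊆ Per(X,f); (b) there exist homeomorphisms ψ_k : Y → X such that ψ_k ∘ g ∘ ψ_k⁻¹ converges uniformly to f. -/

import Mathlib

open Filter

/-- `f` is chain mixing. -/
def ChainMixing {X : Type*} [MetricSpace X] (f : X → X) : Prop :=
  ∀ δ : ℝ, 0 < δ → ∀ x y : X, ∃ N : ℕ, ∀ n ≥ N,
    ∃ c : ℕ → X, c 0 = x ∧ c n = y ∧ ∀ i < n, dist (f (c i)) (c (i + 1)) < δ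


theorem cantor_split {Z : Type*} [TopologicalSpace Z] [CompactSpace Z] [T2Space Z]
    [TotallyDisconnectedSpace Z] [PerfectSpace Z] (C : Set Z) (hC : IsClopen C) (hne : C.Nonempty) :
    ∃ S, IsClopen S ∧ S.Nonempty ∧ (C \ S).Nonempty ∧ S ⊆ C := by
  obtain ⟨x, hx⟩ := hne
  have h1 : ∀ᶠ z in nhdsWithin x {x}ᶜ, z ∈ C := nhdsWithin_le_nhds (hC.isOpen.mem_nhds hx)
  have h2 : ∀ᶠ z in nhdsWithin x {x}ᶜ, z ∈ ({x}ᶜ : Set Z) := eventually_mem_nhdsWithin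
  obtain ⟨y, hy, hyx⟩ := (h1.and h2).exists
  obtain ⟨V, hV, hxV, hVs⟩ := compact_exists_isClopen_in_isOpen (x := x) (U := C ∩ {y}ᶜ)
    (hC.isOpen.inter isOpen_compl_singleton) ⟨hx, fun h => hyx h.symm⟩
  exact ⟨V, hV, ⟨x, hxV⟩, ⟨y, hy, fun h => (hVs h).2 rfl⟩, fun z hz => (hVs hz).1⟩

theorem cantor_homeo (Z : Type*) [TopologicalSpace Z] [CompactSpace Z] [T2Space Z]
    [TotallyDisconnectedSpace Z] [PerfectSpace Z] [SecondCountableTopology Z] [Nonempty Z] :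
    Nonempty (Z ≃ₜ (ℕ → Bool)) := by
  classical
  have : Countable (TopologicalSpace.Clopens Z) :=
    TopologicalSpace.Clopens.countable_iff_secondCountable.2 inferInstance
  obtain ⟨B, hB⟩ := exists_surjective_nat (TopologicalSpace.Clopens Z)
  have hS : ∀ (n : ℕ) (C : Set Z), ∃ S : Set Z, IsClopen C → C.Nonempty →
      IsClopen S ∧ S.Nonempty ∧ (C \ S).Nonempty ∧ S ⊆ C ∧
      ((C ∩ B n).Nonempty → (C \ B n).Nonempty → S = C ∩ B n) := by
    intro n C
    by_cases h : (C ∩ B n).Nonempty ∧ (C \ B n).Nonempty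
    · refine ⟨C ∩ B n, fun hC _ => ⟨hC.inter (B n).isClopen, h.1, ?_, Set.inter_subset_left,
        fun _ _ => rfl⟩⟩
      obtain ⟨z, hz⟩ := h.2
      exact ⟨z, hz.1, fun h => hz.2 h.2⟩
    · by_cases hC : IsClopen C ∧ C.Nonempty
      · obtain ⟨S, h1, h2, h3, h4⟩ := cantor_split C hC.1 hC.2
        exact ⟨S, fun _ _ => ⟨h1, h2, h3, h4, fun a b => (h ⟨a, b⟩).elim⟩⟩
      · exact ⟨∅, fun a b => (hC ⟨a, b⟩).elim⟩
  choose S hS using hS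
  let T : (ℕ → Bool) → ℕ → Set Z := fun b n => Nat.rec Set.univ
    (fun n C => if b n = true then S n C else C \ S n C) n
  have T0 : ∀ b, T b 0 = Set.univ := fun b => rfl
  have Ts : ∀ b n, T b (n+1) = if b n = true then S n (T b n) else T b n \ S n (T b n) :=
    fun b n => rfl
  have Tc : ∀ b n, IsClopen (T b n) ∧ (T b n).Nonempty := by
    intro b n
    induction n with
    | zero => exact ⟨isClopen_univ, Set.univ_nonempty⟩
    | succ n ih =>
      obtain ⟨h1, h2, h3, h4, h5⟩ := hS n _ ih.1 ih.2
      rw [Ts]; split_ifs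
      · exact ⟨h1, h2⟩
      · exact ⟨ih.1.diff h1, h3⟩
  have Tsub : ∀ b n, T b (n+1) ⊆ T b n := by
    intro b n
    obtain ⟨h1, h2, h3, h4, h5⟩ := hS n _ (Tc b n).1 (Tc b n).2
    rw [Ts]; split_ifs
    · exact h4
    · exact Set.sdiff_subset
  have Tne : ∀ b, (⋂ n, T b n).Nonempty := fun b =>
    IsCompact.nonempty_iInter_of_sequence_nonempty_isCompact_isClosed (T b) (Tsub b)
      (fun n => (Tc b n).2) (Tc b 0).1.isClosed.isCompact (fun n => (Tc b n).1.isClosed)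
  choose F hF using Tne
  have hF : ∀ b n, F b ∈ T b n := fun b n => Set.mem_iInter.1 (hF b) n
  -- points in the same set at all levels are equal
  have Tinj : ∀ b x y, (∀ n, x ∈ T b n) → (∀ n, y ∈ T b n) → x = y := by
    intro b x y hx hy
    by_contra hxy
    obtain ⟨V, hV, hxV, hVs⟩ := compact_exists_isClopen_in_isOpen (x := x) (U := {y}ᶜ)
      isOpen_compl_singleton hxy
    obtain ⟨n, hn⟩ := hB ⟨V, hV⟩
    have hn' : (B n : Set Z) = V := by rw [hn]; rfl
    have hyV : y ∉ V := fun h => hVs h rfl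
    have hh := (hS n _ (Tc b n).1 (Tc b n).2).2.2.2.2 ⟨x, hx n, hn' ▸ hxV⟩
      ⟨y, hy n, hn' ▸ hyV⟩
    have a1 := hx (n+1)
    have a2 := hy (n+1)
    rw [Ts, hh, hn'] at a1 a2
    split_ifs at a1 a2
    · exact hyV a2.2
    · exact a1.2 ⟨a1.1, hxV⟩
  have Tex : ∀ x, ∃ b, ∀ n, x ∈ T b n := by
    intro x
    let st : ℕ → Set Z := fun n => Nat.rec Set.univ
      (fun n C => if x ∈ S n C then S n C else C \ S n C) n
    let b : ℕ → Bool := fun n => decide (x ∈ S n (st n))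
    have hst : ∀ n, T b n = st n ∧ x ∈ st n := by
      intro n
      induction n with
      | zero => exact ⟨rfl, trivial⟩
      | succ n ih =>
        have e : st (n+1) = if x ∈ S n (st n) then S n (st n) else st n \ S n (st n) := rfl
        rw [Ts, e, ih.1]
        by_cases h : x ∈ S n (st n)
        · simp [b, h]
        · simp [b, h, ih.2]
    exact ⟨b, fun n => (hst n).1 ▸ (hst n).2⟩
  have Tdep : ∀ b b' n, (∀ i < n, b i = b' i) → T b n = T b' n := by
    intro b b' n
    induction n with
    | zero => intro _; rfl
    | succ n ih =>
      intro h
      rw [Ts, Ts, ih (fun i hi => h i (by omega)), h n (by omega)]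
  have Tdisj : ∀ b b' x, (∀ n, x ∈ T b n) → (∀ n, x ∈ T b' n) → b = b' := by
    intro b b' x h h'
    funext n
    induction n using Nat.strong_induction_on with
    | _ n ih =>
      have e := Tdep b b' n ih
      have a1 := h (n+1)
      have a2 := h' (n+1)
      rw [Ts] at a1 a2
      rw [e] at a1
      cases hb : b n <;> cases hb' : b' n <;> simp_all
  let H : (ℕ → Bool) ≃ Z := Equiv.ofBijective F ⟨by
      intro b b' hbb
      exact Tdisj b b' (F b) (hF b) (hbb ▸ hF b'), by
      intro x
      obtain ⟨b, hb⟩ := Tex x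
      exact ⟨b, Tinj b _ _ (hF b) hb⟩⟩
  have Hc : Continuous H := by
    rw [continuous_iff_continuousAt]
    intro b
    rw [ContinuousAt, tendsto_def]
    intro W hW
    obtain ⟨W', hW'W, hW'o, hbW'⟩ := mem_nhds_iff.1 hW
    obtain ⟨V, hV, hxV, hVs⟩ := compact_exists_isClopen_in_isOpen hW'o hbW'
    obtain ⟨n, hn⟩ := hB ⟨V, hV⟩
    have hn' : (B n : Set Z) = V := by rw [hn]; rfl
    have hev : ∀ᶠ b' in nhds b, ∀ i ∈ Finset.range (n+1), b i = b' i := by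
      rw [eventually_all_finset]
      intro i _
      have : Continuous (fun b' : ℕ → Bool => b' i) := continuous_apply i
      have := (this.tendsto b).eventually (IsOpen.mem_nhds (isOpen_discrete {b i}) rfl)
      filter_upwards [this] with b' hb'
      exact hb'.symm
    filter_upwards [hev] with b' hb'
    have e := Tdep b b' (n+1) (fun i hi => hb' i (Finset.mem_range.2 hi))
    have m : F b' ∈ T b (n+1) := e ▸ hF b' (n+1)
    refine hW'W (hVs ?_)
    change F b' ∈ V
    by_contra hcon
    have hFb : F b ∈ V := hxV
    have hh := (hS n _ (Tc b n).1 (Tc b n).2).2.2.2.2 ⟨F b, hF b n, hn' ▸ hFb⟩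
      ⟨F b', Tsub b n m, hn' ▸ hcon⟩
    have a1 := hF b (n+1)
    rw [Ts, hh, hn'] at a1 m
    split_ifs at a1 m
    · exact hcon m.2
    · exact a1.2 ⟨a1.1, hFb⟩
  exact ⟨(Continuous.homeoOfEquivCompactToT2 Hc).symm⟩

theorem cantor_clopen_homeo {Z : Type*} [MetricSpace Z] [CompactSpace Z] [PerfectSpace Z]
    [TotallyDisconnectedSpace Z] (C : Set Z) (hC : IsClopen C) (hne : C.Nonempty) :
    Nonempty (C ≃ₜ (ℕ → Bool)) := by
  have : CompactSpace C := isCompact_iff_compactSpace.1 hC.isClosed.isCompact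
  have : Nonempty C := hne.to_subtype
  have : PerfectSpace C := by
    rw [perfectSpace_iff_forall_not_isolated]
    intro x
    have hx : (nhdsWithin (x : Z) {(x : Z)}ᶜ).NeBot := inferInstance
    rw [← mem_closure_iff_nhdsWithin_neBot, mem_closure_iff_nhds] at hx ⊢
    intro t ht
    obtain ⟨u, hu, hut⟩ := (mem_nhds_subtype C x t).1 ht
    obtain ⟨z, hz, hzx⟩ := hx (u ∩ C) (inter_mem hu (hC.isOpen.mem_nhds x.2))
    exact ⟨⟨z, hz.2⟩, hut hz.1, fun h => hzx (congrArg Subtype.val h)⟩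
  exact cantor_homeo C

/-- Glueing homeomorphisms of the pieces. -/
theorem glue_homeo {X Y V : Type*} [MetricSpace X] [CompactSpace X] [PerfectSpace X]
    [TotallyDisconnectedSpace X]
    [MetricSpace Y] [CompactSpace Y] [PerfectSpace Y] [TotallyDisconnectedSpace Y]
    (p : X → V) (hp : IsLocallyConstant p) (hps : Function.Surjective p)
    (φ : Y → V) (hφ : IsLocallyConstant φ) (hφs : Function.Surjective φ) :
    ∃ ψ : Y ≃ₜ X, ∀ y, p (ψ y) = φ y := by
  have h : ∀ v, Nonempty ((φ ⁻¹' {v} : Set Y) ≃ₜ (p ⁻¹' {v} : Set X)) := by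
    intro v
    obtain ⟨x, hx⟩ := hps v
    obtain ⟨y, hy⟩ := hφs v
    obtain ⟨e1⟩ := cantor_clopen_homeo (φ ⁻¹' {v}) (hφ.isClopen_fiber v) ⟨y, hy⟩
    obtain ⟨e2⟩ := cantor_clopen_homeo (p ⁻¹' {v}) (hp.isClopen_fiber v) ⟨x, hx⟩
    exact ⟨e1.trans e2.symm⟩
  have e' := fun v => (h v).some
  let F : Y → X := fun y => (e' (φ y) ⟨y, rfl⟩ : X)
  have hF : ∀ v (y : Y) (hy : φ y = v), F y = (e' v ⟨y, hy⟩ : X) := by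
    rintro v y rfl; rfl
  have hpF : ∀ y, p (F y) = φ y := fun y => (e' (φ y) ⟨y, rfl⟩).2
  have hbij : Function.Bijective F := by
    constructor
    · intro y y' hyy
      have h1 : φ y' = φ y := by rw [← hpF, ← hpF, hyy]
      rw [hF _ y rfl, hF _ y' h1] at hyy
      have := (e' (φ y)).injective (Subtype.ext hyy)
      exact congrArg Subtype.val this
    · intro x
      refine ⟨((e' (p x)).symm ⟨x, rfl⟩ : Y), ?_⟩
      rw [hF (p x) _ ((e' (p x)).symm ⟨x, rfl⟩).2]
      simp
  have hcont : Continuous F := by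
    rw [continuous_iff_continuousAt]
    intro y
    have ho : IsOpen (φ ⁻¹' {φ y}) := hφ.isOpen_fiber _
    have : ContinuousOn F (φ ⁻¹' {φ y}) := by
      rw [continuousOn_iff_continuous_domRestrict]
      have : (φ ⁻¹' {φ y}).domRestrict F = fun z => (e' (φ y) z : X) := by
        funext z
        exact hF _ z z.2
      rw [this]
      exact continuous_subtype_val.comp (e' (φ y)).continuous
    exact this.continuousAt (ho.mem_nhds rfl)
  let E := Equiv.ofBijective F hbij
  have hE : Continuous E := hcont
  exact ⟨hE.homeoOfEquivCompactToT2, hpF⟩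


structure GoodPartial {Y V : Type*} [TopologicalSpace Y] (T : ℤ → Y → Y) (A : V → V → Prop) (N : ℕ)
    (D : Set Y) (φ : Y → V) : Prop where
  clopen : IsClopen D
  loc : ∀ y ∈ D, ∀ᶠ z in nhds y, φ z = φ y
  edge : ∀ y ∈ D, T 1 y ∈ D → A (φ y) (φ (T 1 y))
  gap : ∀ y ∈ D, ∀ k : ℕ, 1 ≤ k → k ≤ N → T k y ∈ D → T 1 y ∈ D
  surj : ∀ v, ∃ y ∈ D, φ y = v

theorem good_step {Y V : Type*} [TopologicalSpace Y] (T : ℤ → Y → Y)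
    (T0 : ∀ z, T 0 z = z) (Ta : ∀ a b z, T a (T b z) = T (a + b) z) (Tc : ∀ a, Continuous (T a))
    (A : V → V → Prop) (N : ℕ) (hN : 1 ≤ N) (D : Set Y) (φ : Y → V)
    (h : GoodPartial T A N D φ) (U : Set Y) (hU : IsClopen U) (w : ℕ → V)
    (hw : ∀ i, A (w i) (w (i + 1)))
    (hUw : ∀ i : ℕ, i ≤ N + 1 → ∀ z ∈ U, T i z ∈ U → ∀ j, w (i + j) = w j) :
    ∃ D' φ', GoodPartial T A N D' φ' ∧ D ⊆ D' ∧
      ∀ z ∈ U, ∃ i : ℤ, |i| ≤ 2 * N ∧ T i z ∈ D' := by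
  classical
  let U' : Set Y := U \ ⋃ i ∈ Finset.Icc (-(2 * N : ℤ)) (2 * N), T i ⁻¹' D
  have hU' : IsClopen U' :=
    hU.diff (isClopen_biUnion_finset fun i _ => h.clopen.preimage (Tc i))
  have hU'U : ∀ z ∈ U', z ∈ U := fun z hz => hz.1
  have hU'D : ∀ z ∈ U', ∀ i : ℤ, |i| ≤ 2 * N → T i z ∉ D := by
    intro z hz i hi hD
    apply hz.2
    simp only [Set.mem_iUnion]
    exact ⟨i, Finset.mem_Icc.2 (abs_le.1 hi), hD⟩
  let E : Set Y := {z | ∃ i j : ℕ, i + j ≤ N ∧ T (-i) z ∈ U' ∧ T j z ∈ U'}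
  have hE : IsClopen E := by
    have : E = ⋃ q ∈ (Finset.range (N+1) ×ˢ Finset.range (N+1)).filter (fun q => q.1 + q.2 ≤ N),
        (T (-(q.1 : ℤ)) ⁻¹' U' ∩ T (q.2 : ℤ) ⁻¹' U') := by
      ext z
      simp only [E, Set.mem_iUnion, Set.mem_ofPred_eq, Finset.mem_filter, Finset.mem_product,
        Finset.mem_range, Set.mem_inter_iff, Set.mem_preimage]
      constructor
      · rintro ⟨i, j, hij, h1, h2⟩
        exact ⟨(i, j), ⟨⟨by simp; omega, by simp; omega⟩, hij⟩, h1, h2⟩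
      · rintro ⟨⟨i, j⟩, ⟨_, hij⟩, h1, h2⟩
        exact ⟨i, j, hij, h1, h2⟩
    rw [this]
    exact isClopen_biUnion_finset fun q _ => (hU'.preimage (Tc _)).inter (hU'.preimage (Tc _))
  have hU'E : ∀ z ∈ U', z ∈ E := fun z hz => ⟨0, 0, by simp, by simpa [T0] using hz,
    by simpa [T0] using hz⟩
  have hED : ∀ z ∈ E, ∀ m : ℤ, |m| ≤ N → T m z ∉ D := by
    rintro z ⟨i, j, hij, h1, h2⟩ m hm
    have := hU'D _ h1 (m + i) (by rw [abs_le] at *; omega)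
    rwa [Ta, show m + i + -(i : ℤ) = m by ring] at this
  have hED0 : ∀ z ∈ E, z ∉ D := by
    intro z hz
    have := hED z hz 0 (by simp)
    rwa [T0] at this
  have wd0 : ∀ z (i i' : ℕ), i ≤ i' → i' ≤ N + 1 → T (-i) z ∈ U → T (-i') z ∈ U →
      w i' = w i := by
    intro z i i' hi hi' h1 h2
    have := hUw (i' - i) (by omega) _ h2 (by
      rw [Ta]
      have e : ((i' - i : ℕ) : ℤ) + -(i' : ℤ) = -i := by omega
      rwa [e]) i
    rwa [Nat.sub_add_cancel hi] at this
  have wd : ∀ z (i i' : ℕ), i ≤ N + 1 → i' ≤ N + 1 → T (-i) z ∈ U → T (-i') z ∈ U →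
      w i' = w i := by
    intro z i i' hi hi' h1 h2
    rcases le_total i i' with hh | hh
    · exact wd0 z i i' hh hi' h1 h2
    · exact (wd0 z i' i hh hi h2 h1).symm
  let φ' : Y → V := fun z => if z ∈ D then φ z else
    if hz : ∃ i : ℕ, i ≤ N ∧ T (-i) z ∈ U then w hz.choose else φ z
  have φD : ∀ z ∈ D, φ' z = φ z := fun z hz => if_pos hz
  have φE : ∀ z ∈ E, ∀ i : ℕ, i ≤ N + 1 → T (-i) z ∈ U → φ' z = w i := by
    intro z hz i hi hi2
    have hz2 : ∃ i : ℕ, i ≤ N ∧ T (-i) z ∈ U := by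
      obtain ⟨i, j, hij, h1, h2⟩ := hz
      exact ⟨i, by omega, hU'U _ h1⟩
    have e : φ' z = w hz2.choose := by
      simp only [φ']
      rw [if_neg (hED0 z hz), dif_pos hz2]
    rw [e]
    exact wd z _ _ hi (by have := hz2.choose_spec.1; omega) hi2 hz2.choose_spec.2
  have noDE : ∀ y ∈ D, ∀ k : ℕ, k ≤ N → T k y ∉ E := by
    intro y hy k hk hE
    apply hED _ hE (-k) (by rw [abs_neg]; simpa using hk)
    rw [Ta]; simpa [T0] using hy
  have noED : ∀ y ∈ E, ∀ k : ℕ, k ≤ N → T k y ∉ D := by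
    intro y hy k hk
    exact hED _ hy k (by simpa using hk)
  refine ⟨D ∪ E, φ', ⟨h.clopen.union hE, ?_, ?_, ?_, ?_⟩, Set.subset_union_left, ?_⟩
  · rintro y (hy | hy)
    · filter_upwards [h.loc y hy, h.clopen.isOpen.mem_nhds hy] with z h1 h2
      rw [φD z h2, φD y hy, h1]
    · obtain ⟨i, j, hij, h1, h2⟩ := id hy
      filter_upwards [hE.isOpen.mem_nhds hy,
        (hU.preimage (Tc (-i))).isOpen.mem_nhds (hU'U _ h1)] with z h3 h4
      rw [φE z h3 i (by omega) h4, φE y hy i (by omega) (hU'U _ h1)]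
  · rintro y (hy | hy) (hy' | hy')
    · rw [φD _ hy, φD _ hy']; exact h.edge y hy hy'
    · exact (noDE y hy 1 hN hy').elim
    · exact (noED y hy 1 hN hy').elim
    · obtain ⟨i, j, hij, h1, h2⟩ := id hy
      rw [φE y hy i (by omega) (hU'U _ h1), φE _ hy' (i + 1) (by omega) (by
        rw [Ta]; convert hU'U _ h1 using 2; push_cast; ring)]
      exact hw i
  · rintro y (hy | hy) k hk1 hk2 (hy' | hy')
    · exact Or.inl (h.gap y hy k hk1 hk2 hy')
    · exact (noDE y hy k hk2 hy').elim
    · exact (noED y hy k hk2 hy').elim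
    · right
      obtain ⟨i, j, hij, h1, h2⟩ := hy
      obtain ⟨i', j', hij', h1', h2'⟩ := hy'
      rw [Ta] at h1' h2'
      by_cases hj : 1 ≤ j
      · refine ⟨i + 1, j - 1, by omega, ?_, ?_⟩
        · rw [Ta]; convert h1 using 2; push_cast; ring
        · rw [Ta]; convert h2 using 2; omega
      · have hj0 : j = 0 := by omega
        subst hj0
        by_cases hk : i' < k
        · refine ⟨1, k - i' - 1, by omega, ?_, ?_⟩
          · rw [Ta]; convert h2 using 2; simp
          · rw [Ta]; convert h1' using 2; omega
        · refine ⟨1, k + j' - 1, by omega, ?_, ?_⟩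
          · rw [Ta]; convert h2 using 2; simp
          · rw [Ta]; convert h2' using 2; omega
  · intro v
    obtain ⟨y, hy, hv⟩ := h.surj v
    exact ⟨y, Or.inl hy, by rw [φD y hy, hv]⟩
  · intro z hz
    by_cases hz' : z ∈ U'
    · exact ⟨0, by simp, by rw [T0]; exact Or.inr (hU'E z hz')⟩
    · have : ∃ i ∈ Finset.Icc (-(2 * N : ℤ)) (2 * N), T i z ∈ D := by
        by_contra hcon
        apply hz'
        refine ⟨hz, ?_⟩
        simp only [Set.mem_iUnion]
        rintro ⟨i, hi, hD⟩
        exact hcon ⟨i, hi, hD⟩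
      obtain ⟨i, hi, hD⟩ := this
      exact ⟨i, abs_le.2 (Finset.mem_Icc.1 hi), Or.inl hD⟩

theorem good_fill {Y V : Type*} [TopologicalSpace Y] (T : ℤ → Y → Y)
    (T0 : ∀ z, T 0 z = z) (Ta : ∀ a b z, T a (T b z) = T (a + b) z) (Tc : ∀ a, Continuous (T a))
    (A : V → V → Prop) (N : ℕ) (D : Set Y) (φ : Y → V)
    (h : GoodPartial T A N D φ) (K : ℤ) (hK : ∀ z, ∃ i : ℤ, |i| ≤ K ∧ T i z ∈ D)
    (hmix : ∀ a b : V, ∀ n ≥ N, ∃ w : ℕ → V, w 0 = a ∧ w n = b ∧ ∀ i < n, A (w i) (w (i + 1))) :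
    ∃ φ' : Y → V, IsLocallyConstant φ' ∧ Function.Surjective φ' ∧
      ∀ y, A (φ' y) (φ' (T 1 y)) := by
  classical
  have hP : ∀ (a b : V) (n : ℕ), ∃ w : ℕ → V, w 0 = a ∧
      ((N ≤ n ∨ (n = 1 ∧ A a b)) → w n = b ∧ ∀ i < n, A (w i) (w (i + 1))) := by
    intro a b n
    by_cases h1 : N ≤ n
    · obtain ⟨w, h1, h2, h3⟩ := hmix a b n h1
      exact ⟨w, h1, fun _ => ⟨h2, h3⟩⟩
    · by_cases h2 : n = 1 ∧ A a b
      · refine ⟨fun i => if i = 0 then a else b, by simp, fun _ => ⟨by simp [h2.1], ?_⟩⟩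
        intro i hi
        have : i = 0 := by omega
        subst this
        simpa using h2.2
      · exact ⟨fun _ => a, rfl, fun h => (h.elim h1 h2).elim⟩
  choose P hP0 hP using hP
  let G : Y → ℕ → ℕ → Prop := fun z s t => T (-s) z ∈ D ∧ 1 ≤ t ∧ T t z ∈ D ∧
    ∀ m : ℤ, -s < m → m < t → T m z ∉ D
  have Guniq : ∀ z s t s' t', G z s t → G z s' t' → s = s' ∧ t = t' := by
    rintro z s t s' t' ⟨a1, a2, a3, a4⟩ ⟨b1, b2, b3, b4⟩
    constructor
    · rcases lt_trichotomy s s' with hs | hs | hs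
      · exact (b4 (-s) (by omega) (by omega) a1).elim
      · exact hs
      · exact (a4 (-s') (by omega) (by omega) b1).elim
    · rcases lt_trichotomy t t' with hs | hs | hs
      · exact (b4 t (by omega) (by omega) a3).elim
      · exact hs
      · exact (a4 t' (by omega) (by omega) b3).elim
  have Gex : ∀ z, ∃ s t, G z s t := by
    intro z
    have h1 : ∃ s : ℕ, T (-s) z ∈ D := by
      obtain ⟨i, hi, hD⟩ := hK (T (-K) z)
      rw [Ta] at hD
      rw [abs_le] at hi
      refine ⟨(K - i).toNat, ?_⟩
      convert hD using 2; omega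
    have h2 : ∃ t : ℕ, 1 ≤ t ∧ T t z ∈ D := by
      obtain ⟨i, hi, hD⟩ := hK (T (K + 1) z)
      rw [Ta] at hD
      rw [abs_le] at hi
      refine ⟨(i + (K + 1)).toNat, by omega, ?_⟩
      convert hD using 2; omega
    refine ⟨Nat.find h1, Nat.find h2, Nat.find_spec h1, (Nat.find_spec h2).1,
      (Nat.find_spec h2).2, ?_⟩
    intro m hm1 hm2 hmD
    by_cases hm : 1 ≤ m
    · refine Nat.find_min h2 (m := m.toNat) (by omega) ⟨by omega, ?_⟩
      convert hmD using 2; omega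
    · refine Nat.find_min h1 (m := (-m).toNat) (by omega) ?_
      convert hmD using 2; omega
  choose s t hst using Gex
  let φ' : Y → V := fun z => P (φ (T (-(s z)) z)) (φ (T (t z) z)) (s z + t z) (s z)
  have hφ' : ∀ z s t, G z s t → φ' z = P (φ (T (-s) z)) (φ (T t z)) (s + t) s := by
    intro z s' t' hG
    obtain ⟨rfl, rfl⟩ := Guniq _ _ _ _ _ (hst z) hG
    rfl
  have hφD : ∀ z ∈ D, φ' z = φ z := by
    intro z hz
    have : s z = 0 := by
      by_contra hne
      exact (hst z).2.2.2 0 (by omega) (by have := (hst z).2.1; omega) (by rwa [T0])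
    simp only [φ', this, hP0]
    simp [T0]
  refine ⟨φ', ?_, ?_, ?_⟩
  · rw [IsLocallyConstant.iff_eventually_eq]
    intro y
    obtain ⟨a1, a2, a3, a4⟩ := hst y
    have e1 : ∀ᶠ z in nhds y, ∀ m ∈ Finset.Ioo (-(s y : ℤ)) (t y), T m z ∉ D := by
      rw [eventually_all_finset]
      intro m hm
      rw [Finset.mem_Ioo] at hm
      exact (h.clopen.compl.preimage (Tc m)).isOpen.mem_nhds (a4 m hm.1 hm.2)
    filter_upwards [e1, (h.clopen.preimage (Tc _)).isOpen.mem_nhds a1,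
      (h.clopen.preimage (Tc _)).isOpen.mem_nhds a3,
      ((Tc _).tendsto y).eventually (h.loc _ a1), ((Tc _).tendsto y).eventually (h.loc _ a3)]
      with z b1 b2 b3 b4 b5
    rw [hφ' z (s y) (t y) ⟨b2, a2, b3, fun m h1 h2 => b1 m (Finset.mem_Ioo.2 ⟨h1, h2⟩)⟩,
      b4, b5]
  · intro v
    obtain ⟨y, hy, hv⟩ := h.surj v
    exact ⟨y, by rw [hφD y hy, hv]⟩
  · intro y
    obtain ⟨a1, a2, a3, a4⟩ := hst y
    have hr : N ≤ s y + t y ∨ (s y + t y = 1 ∧ A (φ (T (-(s y)) y)) (φ (T (t y) y))) := by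
      by_cases hN : N ≤ s y + t y
      · exact Or.inl hN
      right
      have hg := h.gap _ a1 (s y + t y) (by omega) (by omega) (by
        rw [Ta]; convert a3 using 2; push_cast; ring)
      have h1 : s y + t y = 1 := by
        by_contra hne
        rw [Ta] at hg
        exact a4 _ (by omega) (by omega) hg
      refine ⟨h1, ?_⟩
      have := h.edge _ a1 hg
      rw [Ta] at this
      convert this using 3; omega
    obtain ⟨c1, c2⟩ := hP _ _ _ hr
    have c3 := c2 (s y) (by omega)
    change A (P _ _ _ _) _
    convert c3 using 1
    by_cases ht : t y = 1
    · have : T 1 y ∈ D := by simpa [ht] using a3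
      rw [hφD _ this]
      rw [ht] at c1
      rw [ht, c1]; simp
    · have : G (T 1 y) (s y + 1) (t y - 1) := by
        refine ⟨?_, by omega, ?_, ?_⟩
        · rw [Ta]; convert a1 using 2; push_cast; ring
        · rw [Ta]; convert a3 using 2; omega
        · intro m hm1 hm2
          rw [Ta]
          exact a4 _ (by omega) (by omega)
      rw [hφ' _ _ _ this, Ta, Ta]
      have e1 : -((s y + 1 : ℕ) : ℤ) + 1 = -(s y) := by push_cast; ring
      have e2 : ((t y - 1 : ℕ) : ℤ) + 1 = t y := by omega
      have e3 : s y + 1 + (t y - 1) = s y + t y := by omega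
      rw [e1, e2, e3]

theorem small_nbhd {Y : Type*} [TopologicalSpace Y] [CompactSpace Y] [T2Space Y]
    [TotallyDisconnectedSpace Y] (T : ℤ → Y → Y) (Tc : ∀ a, Continuous (T a)) (M : ℕ) (y : Y) :
    ∃ U : Set Y, IsClopen U ∧ y ∈ U ∧ ∀ i : ℕ, i ≤ M → ∀ z ∈ U, T i z ∈ U → T i y = y := by
  have h1 : ∀ᶠ q : Y × Y in nhds y ×ˢ nhds y, ∀ i ∈ Finset.range (M + 1),
      T i y ≠ y → T i q.1 ≠ q.2 := by
    rw [eventually_all_finset]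
    intro i _
    by_cases hi : T i y = y
    · simp [hi]
    · have : IsOpen {q : Y × Y | T i q.1 ≠ q.2} :=
        isOpen_ne_fun ((Tc i).comp continuous_fst) continuous_snd
      rw [← nhds_prod_eq]
      filter_upwards [this.mem_nhds (show (y, y) ∈ _ from hi)] with q hq _
      exact hq
  rw [eventually_prod_self_iff'] at h1
  obtain ⟨t, ht, h1⟩ := h1
  obtain ⟨W', hW'W, hW'o, hbW'⟩ := mem_nhds_iff.1 ht
  obtain ⟨V, hV, hxV, hVs⟩ := compact_exists_isClopen_in_isOpen hW'o hbW'
  refine ⟨V, hV, hxV, ?_⟩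
  intro i hi z hz hz'
  by_contra hne
  exact h1 z (hW'W (hVs hz)) (T i z) (hW'W (hVs hz')) i (Finset.mem_range.2 (by omega)) hne rfl

theorem good_init {Y V : Type*} [TopologicalSpace Y] [CompactSpace Y] [T2Space Y]
    [TotallyDisconnectedSpace Y] [Finite V] [Nonempty V] (T : ℤ → Y → Y)
    (T0 : ∀ z, T 0 z = z) (Ta : ∀ a b z, T a (T b z) = T (a + b) z) (Tc : ∀ a, Continuous (T a))
    (A : V → V → Prop) (N : ℕ) (hN : 1 ≤ N)
    (hap : ∀ M : ℕ, ∃ y, ∀ i : ℕ, 1 ≤ i → i ≤ M → T i y ≠ y) :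
    ∃ D φ, GoodPartial T A N D φ := by
  classical
  obtain ⟨n, ⟨e⟩⟩ := Finite.exists_equiv_fin V
  obtain ⟨y, hy⟩ := hap (n * (N + 1))
  obtain ⟨U, hU, hyU, hUT⟩ := small_nbhd T Tc (n * (N + 1)) y
  let a : V → ℕ := fun v => (e v : ℕ) * (N + 1)
  have ha : ∀ v, a v + (N + 1) ≤ n * (N + 1) := by
    intro v
    have : ((e v : ℕ) + 1) * (N + 1) ≤ n * (N + 1) := Nat.mul_le_mul_right _ (e v).2
    simp only [a]; linarith
  have hlt : ∀ v v', (e v : ℕ) < e v' → a v + (N + 1) ≤ a v' := by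
    intro v v' h
    have : ((e v : ℕ) + 1) * (N + 1) ≤ (e v' : ℕ) * (N + 1) := Nat.mul_le_mul_right _ h
    simp only [a]; linarith
  have hU0 : ∀ m : ℕ, m ≤ n * (N + 1) → ∀ z ∈ U, T m z ∈ U → m = 0 := by
    intro m hm z hz hz'
    by_contra hne
    exact hy m (by omega) hm (hUT m hm z hz hz')
  have key : ∀ v v' z (k : ℕ), k ≤ N → T (-(a v)) z ∈ U → T (-(a v')) (T k z) ∈ U →
      k = 0 ∧ v = v' := by
    intro v v' z k hk h1 h2
    have hav := ha v
    have hav' := ha v'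
    rw [Ta] at h2
    have hm : k + a v = a v' := by
      rcases le_total (a v') (k + a v) with hle | hle
      · have := hU0 (k + a v - a v') (by omega) _ h1 (by
          rw [Ta]; convert h2 using 2; omega)
        omega
      · have := hU0 (a v' - (k + a v)) (by omega) _ h2 (by
          rw [Ta]; convert h1 using 2; omega)
        omega
    rcases lt_trichotomy (e v : ℕ) (e v') with hh | hh | hh
    · have := hlt _ _ hh; omega
    · have : v = v' := e.injective (Fin.ext hh)
      subst this
      exact ⟨by omega, rfl⟩
    · have := hlt _ _ hh; omega
  have key0 : ∀ v v' z, T (-(a v)) z ∈ U → T (-(a v')) z ∈ U → v = v' := by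
    intro v v' z h1 h2
    refine (key v v' z 0 (by omega) h1 ?_).2
    simpa [T0] using h2
  let D : Set Y := ⋃ v, T (-(a v)) ⁻¹' U
  have hD : ∀ z, z ∈ D ↔ ∃ v, T (-(a v)) z ∈ U := by intro z; simp [D]
  let φ : Y → V := fun z => if h : ∃ v, T (-(a v)) z ∈ U then h.choose else Classical.arbitrary V
  have hφ : ∀ z v, T (-(a v)) z ∈ U → φ z = v := by
    intro z v h
    have h' : ∃ v, T (-(a v)) z ∈ U := ⟨v, h⟩
    simp only [φ]
    rw [dif_pos h']
    exact key0 _ _ z h'.choose_spec h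
  have nogap : ∀ y ∈ D, ∀ k : ℕ, 1 ≤ k → k ≤ N → T k y ∉ D := by
    intro y hy k hk1 hk2 hy'
    obtain ⟨v, hv⟩ := (hD _).1 hy
    obtain ⟨v', hv'⟩ := (hD _).1 hy'
    have := (key v v' y k hk2 hv hv').1
    omega
  refine ⟨D, φ, isClopen_iUnion_of_finite fun v => hU.preimage (Tc _), ?_, ?_, ?_, ?_⟩
  · intro y hy
    obtain ⟨v, hv⟩ := (hD _).1 hy
    filter_upwards [(hU.preimage (Tc (-(a v)))).isOpen.mem_nhds hv] with z hz
    rw [hφ z v hz, hφ y v hv]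
  · intro y hy hy'
    exact (nogap y hy 1 le_rfl hN hy').elim
  · intro y hy k hk1 hk2 hy'
    exact (nogap y hy k hk1 hk2 hy').elim
  · intro v
    have : T (-(a v)) (T (a v) y) ∈ U := by rw [Ta]; simpa [T0] using hyU
    exact ⟨T (a v) y, (hD _).2 ⟨v, this⟩, hφ _ _ this⟩

theorem coding {Y V : Type*} [TopologicalSpace Y] [CompactSpace Y] [T2Space Y]
    [TotallyDisconnectedSpace Y] [Finite V] [Nonempty V] (T : ℤ → Y → Y)
    (T0 : ∀ z, T 0 z = z) (Ta : ∀ a b z, T a (T b z) = T (a + b) z) (Tc : ∀ a, Continuous (T a))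
    (A : V → V → Prop) (N : ℕ) (hN : 1 ≤ N)
    (hap : ∀ M : ℕ, ∃ y, ∀ i : ℕ, 1 ≤ i → i ≤ M → T i y ≠ y)
    (hw : ∀ y, ∃ w : ℕ → V, (∀ i, A (w i) (w (i + 1))) ∧
      ∀ i : ℕ, T i y = y → ∀ j, w (i + j) = w j)
    (hmix : ∀ a b : V, ∀ n ≥ N, ∃ w : ℕ → V, w 0 = a ∧ w n = b ∧ ∀ i < n, A (w i) (w (i + 1))) :
    ∃ φ' : Y → V, IsLocallyConstant φ' ∧ Function.Surjective φ' ∧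
      ∀ y, A (φ' y) (φ' (T 1 y)) := by
  classical
  choose w hw1 hw2 using hw
  choose U hU hyU hUT using small_nbhd T Tc (N + 1)
  obtain ⟨S, hS⟩ := isCompact_univ.elim_finite_subcover U (fun y => (hU y).isOpen)
    (fun y _ => Set.mem_iUnion.2 ⟨y, hyU y⟩)
  have ind : ∀ S : Finset Y, ∃ D φ, GoodPartial T A N D φ ∧
      ∀ y ∈ S, ∀ z ∈ U y, ∃ i : ℤ, |i| ≤ 2 * N ∧ T i z ∈ D := by
    intro S
    induction S using Finset.induction_on with
    | empty =>
      obtain ⟨D, φ, h⟩ := good_init T T0 Ta Tc A N hN hap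
      exact ⟨D, φ, h, by simp⟩
    | insert y S _ ih =>
      obtain ⟨D, φ, h, h2⟩ := ih
      obtain ⟨D', φ', h', hs, h3⟩ := good_step T T0 Ta Tc A N hN D φ h (U y) (hU y) (w y) (hw1 y)
        (fun i hi z hz hz' => hw2 y i (hUT y i hi z hz hz'))
      refine ⟨D', φ', h', ?_⟩
      intro y' hy' z hz
      rcases Finset.mem_insert.1 hy' with rfl | hy'
      · exact h3 z hz
      · obtain ⟨i, hi, hD⟩ := h2 y' hy' z hz
        exact ⟨i, hi, hs hD⟩
  obtain ⟨D, φ, h, h2⟩ := ind S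
  refine good_fill T T0 Ta Tc A N D φ h (2 * N) ?_ hmix
  intro z
  obtain ⟨y, hy, hz⟩ := Set.mem_iUnion₂.1 (hS (Set.mem_univ z))
  exact h2 y hy z hz

theorem fine_partition {X : Type*} [MetricSpace X] [CompactSpace X]
    [TotallyDisconnectedSpace X] (η : ℝ) (hη : 0 < η) :
    ∃ (n : ℕ) (p : X → (Fin n → Prop)), IsLocallyConstant p ∧
      ∀ x x', p x = p x' → dist x x' < η := by
  classical
  have : ∀ x : X, ∃ C : Set X, IsClopen C ∧ x ∈ C ∧ C ⊆ Metric.ball x (η / 2) := fun x =>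
    compact_exists_isClopen_in_isOpen Metric.isOpen_ball (Metric.mem_ball_self (by linarith))
  choose C hC hxC hCs using this
  obtain ⟨S, hS⟩ := isCompact_univ.elim_finite_subcover C (fun y => (hC y).isOpen)
    (fun y _ => Set.mem_iUnion.2 ⟨y, hxC y⟩)
  let e := S.equivFin
  refine ⟨S.card, fun x i => x ∈ C (e.symm i), ?_, ?_⟩
  · rw [IsLocallyConstant.iff_eventually_eq]
    intro x
    have : ∀ᶠ z in nhds x, ∀ i : Fin S.card, (z ∈ C (e.symm i) ↔ x ∈ C (e.symm i)) := by
      rw [eventually_all]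
      intro i
      by_cases hx : x ∈ C (e.symm i)
      · filter_upwards [(hC _).isOpen.mem_nhds hx] with z hz
        exact ⟨fun _ => hx, fun _ => hz⟩
      · filter_upwards [(hC _).compl.isOpen.mem_nhds hx] with z hz
        exact ⟨fun h => (hz h).elim, fun h => (hx h).elim⟩
    filter_upwards [this] with z hz
    funext i
    exact propext (hz i)
  · intro x x' h
    obtain ⟨y, hy, hx⟩ := Set.mem_iUnion₂.1 (hS (Set.mem_univ x))
    have h1 := congrFun h (e ⟨y, hy⟩)
    simp only [Equiv.symm_apply_apply, eq_iff_iff] at h1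
    have a1 := Metric.mem_ball.1 (hCs y hx)
    have a2 := Metric.mem_ball.1 (hCs y (h1.1 hx))
    have := dist_triangle_right x x' y
    linarith

theorem homeo_pow_apply {Y : Type*} [TopologicalSpace Y] (g : Y ≃ₜ Y) (n : ℕ) (y : Y) :
    (g ^ (n : ℤ)) y = (⇑g)^[n] y := by
  rw [zpow_natCast]
  induction n generalizing y with
  | zero => rfl
  | succ n ih => rw [pow_succ, Homeomorph.mul_apply, ih]; rfl

theorem approx_conj {X Y : Type*}
    [MetricSpace X] [CompactSpace X] [PerfectSpace X]
    [TotallyDisconnectedSpace X] [Nonempty X]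
    [MetricSpace Y] [CompactSpace Y] [PerfectSpace Y]
    [TotallyDisconnectedSpace Y] [Nonempty Y]
    (f : X → X) (hf : Continuous f)
    (hcm : ChainMixing f)
    (g : Y ≃ₜ Y) (haper : ∀ n : ℕ, 1 ≤ n → (⇑g)^[n] ≠ id)
    (hper : ∀ n : ℕ, 1 ≤ n → (∃ y : Y, (⇑g)^[n] y = y) → ∃ x : X, f^[n] x = x)
    (ε : ℝ) (hε : 0 < ε) : ∃ ψ : Y ≃ₜ X, ∀ x, dist (f x) (ψ (g (ψ.symm x))) < ε := by
  classical
  obtain ⟨η, hη, hfη⟩ := Metric.uniformContinuous_iff.1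
    (CompactSpace.uniformContinuous_of_continuous hf) (ε / 2) (by linarith)
  obtain ⟨n, p0, hp0, hpd0⟩ := fine_partition (X := X) (min η (ε / 2)) (lt_min hη (by linarith))
  let p : X → Set.range p0 := fun x => ⟨p0 x, x, rfl⟩
  have hps : Function.Surjective p := by
    rintro ⟨_, x, rfl⟩; exact ⟨x, rfl⟩
  have hp : IsLocallyConstant p := by
    rw [IsLocallyConstant.iff_eventually_eq] at hp0 ⊢
    intro x
    filter_upwards [hp0 x] with z hz
    exact Subtype.ext hz
  have hpd : ∀ x x', p x = p x' → dist x x' < min η (ε / 2) := fun x x' h =>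
    hpd0 x x' (congrArg Subtype.val h)
  clear_value p
  let V := Set.range p0
  change X → V at p
  have hfin : Finite V := inferInstance
  have hne : Nonempty V := ⟨p (Classical.arbitrary X)⟩
  obtain ⟨δ, hδ, hδp⟩ := lebesgue_number_lemma_of_metric (s := Set.univ) isCompact_univ
    (c := fun v => p ⁻¹' {v}) (fun v => hp.isOpen_fiber v)
    (fun x _ => Set.mem_iUnion.2 ⟨p x, rfl⟩)
  have hδ' : ∀ x x', dist x x' < δ → p x = p x' := by
    intro x x' h
    obtain ⟨v, hv⟩ := hδp x (Set.mem_univ _)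
    have h1 : p x = v := hv (Metric.mem_ball_self hδ)
    have h2 : p x' = v := hv (by rwa [Metric.mem_ball, dist_comm])
    rw [h1, h2]
  let A : V → V → Prop := fun a b => ∃ x, p x = a ∧ p (f x) = b
  have hmix : ∃ N : ℕ, 1 ≤ N ∧ ∀ a b : V, ∀ n ≥ N, ∃ w : ℕ → V, w 0 = a ∧ w n = b ∧
      ∀ i < n, A (w i) (w (i + 1)) := by
    choose r hr using hps
    choose M hM using fun q : V × V => hcm δ hδ (r q.1) (r q.2)
    have := Fintype.ofFinite V
    refine ⟨Finset.univ.sup M + 1, by omega, ?_⟩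
    intro a b n hn
    have : M (a, b) ≤ Finset.univ.sup M := Finset.le_sup (Finset.mem_univ _)
    obtain ⟨c, h0, h1, h2⟩ := hM (a, b) n (by omega)
    refine ⟨fun i => p (c i), by simp [h0, hr], by simp [h1, hr], ?_⟩
    intro i hi
    exact ⟨c i, rfl, hδ' _ _ (h2 i hi)⟩
  obtain ⟨N, hN, hmix⟩ := hmix
  let T : ℤ → Y → Y := fun i => ⇑(g ^ i)
  have Tn : ∀ (i : ℕ) y, T i y = (⇑g)^[i] y := fun i y => homeo_pow_apply g i y
  obtain ⟨φ, h1, h2, h3⟩ := coding T (fun z => by simp [T])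
    (fun a b z => by simp only [T]; rw [zpow_add]; rfl) (fun a => (g ^ a).continuous) A N hN (by
      intro M
      have := haper M.factorial (Nat.factorial_pos M)
      obtain ⟨y, hy⟩ := Function.ne_iff.1 this
      refine ⟨y, fun i hi hiM hyi => hy ?_⟩
      rw [Tn] at hyi
      have : Function.IsPeriodicPt g i y := hyi
      exact this.trans_dvd (Nat.dvd_factorial (by omega) hiM)) (by
      intro y
      have : ∃ x, Function.IsPeriodicPt f (Function.minimalPeriod g y) x := by
        rcases Nat.eq_zero_or_pos (Function.minimalPeriod g y) with h | h
        · rw [h]; exact ⟨Classical.arbitrary X, rfl⟩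
        · exact hper _ h ⟨y, Function.iterate_minimalPeriod⟩
      obtain ⟨x, hx⟩ := this
      refine ⟨fun i => p (f^[i] x), fun i => ⟨f^[i] x, rfl, ?_⟩, ?_⟩
      · change p (f (f^[i] x)) = p (f^[i + 1] x)
        rw [Function.iterate_succ_apply']
      · intro i hi j
        rw [Tn] at hi
        have hi : Function.IsPeriodicPt g i y := hi
        have : f^[i] x = x := hx.trans_dvd hi.minimalPeriod_dvd
        change p (f^[i + j] x) = p (f^[j] x)
        rw [add_comm, Function.iterate_add_apply, this]) hmix
  obtain ⟨ψ, hψ⟩ := glue_homeo p hp hps φ h1 h2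
  refine ⟨ψ, fun x => ?_⟩
  have hT1 : T 1 (ψ.symm x) = g (ψ.symm x) := by simp [T]
  obtain ⟨u, hu1, hu2⟩ := h3 (ψ.symm x)
  rw [hT1, ← hψ] at hu2
  rw [← hψ, ψ.apply_symm_apply] at hu1
  have a1 := hfη ((hpd _ _ hu1.symm).trans_le (min_le_left _ _))
  have a2 := (hpd _ _ hu2).trans_le (min_le_right _ _)
  have := dist_triangle (f x) (f u) (ψ (g (ψ.symm x)))
  linarith

/-- Main theorem: for a chain mixing continuous surjection `f` of a Cantor space `X`
and an aperiodic homeomorphism `g` of a Cantor space `Y`, `Per(Y,g) ⊆ Per(X,f)` iff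
homeomorphisms conjugate to `g` approximate `f` uniformly. -/
theorem stmt_17 {X Y : Type*}
    [MetricSpace X] [CompactSpace X] [PerfectSpace X]
    [TotallyDisconnectedSpace X] [Nonempty X]
    [MetricSpace Y] [CompactSpace Y] [PerfectSpace Y]
    [TotallyDisconnectedSpace Y] [Nonempty Y]
    (f : X → X) (hf : Continuous f) (hsurj : Function.Surjective f)
    (hcm : ChainMixing f)
    (g : Y ≃ₜ Y) (haper : ∀ n : ℕ, 1 ≤ n → (⇑g)^[n] ≠ id) :
    (∀ n : ℕ, 1 ≤ n → (∃ y : Y, (⇑g)^[n] y = y) → ∃ x : X, f^[n] x = x) ↔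
      ∃ ψ : ℕ → Y ≃ₜ X,
        TendstoUniformly (fun k x => ψ k (g ((ψ k).symm x))) f atTop := by
  constructor
  · intro hper
    choose ψ hψ using fun k : ℕ => approx_conj f hf hcm g haper hper (1 / ((k : ℝ) + 1))
      (by positivity)
    refine ⟨ψ, ?_⟩
    rw [Metric.tendstoUniformly_iff]
    intro ε hε
    filter_upwards [tendsto_one_div_add_atTop_nhds_zero_nat.eventually (gt_mem_nhds hε)]
      with k hk x
    exact (hψ k x).trans hk
  · rintro ⟨ψ, hψ⟩ n hn ⟨y, hy⟩
    have hfu := CompactSpace.uniformContinuous_of_continuous hf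
    have hit : ∀ m : ℕ, TendstoUniformly
        (fun k x => (fun x => ψ k (g ((ψ k).symm x)))^[m] x) (f^[m]) atTop := by
      intro m
      induction m with
      | zero =>
        rw [Metric.tendstoUniformly_iff]
        intro ε hε
        exact Eventually.of_forall fun k x => by simpa using hε
      | succ m ih =>
        rw [Metric.tendstoUniformly_iff] at *
        intro ε hε
        obtain ⟨η, hη, hfη⟩ := Metric.uniformContinuous_iff.1 hfu (ε / 2) (by linarith)
        filter_upwards [ih η hη, hψ (ε / 2) (by linarith)] with k h1 h2 x
        rw [Function.iterate_succ_apply', Function.iterate_succ_apply']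
        have a1 := hfη (h1 x)
        have a2 := h2 ((fun x => ψ k (g ((ψ k).symm x)))^[m] x)
        exact (dist_triangle _ _ _).trans_lt (by linarith)
    have hconj : ∀ k m, (fun x => ψ k (g ((ψ k).symm x)))^[m] (ψ k y) = ψ k ((⇑g)^[m] y) := by
      intro k m
      induction m with
      | zero => rfl
      | succ m ih =>
        rw [Function.iterate_succ_apply', Function.iterate_succ_apply', ih]
        simp
    have hfn : Continuous (f^[n]) := hf.iterate n
    obtain ⟨x, _, hx⟩ := isCompact_univ.exists_isMinOn (Set.univ_nonempty (α := X))
      (f := fun x => dist (f^[n] x) x) (by fun_prop)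
    refine ⟨x, ?_⟩
    by_contra hne
    obtain ⟨k, hk⟩ := (Metric.tendstoUniformly_iff.1 (hit n) _ (dist_pos.2 hne)).exists
    have h1 := hk (ψ k y)
    rw [hconj, hy] at h1
    have h2 := hx (Set.mem_univ (ψ k y))
    exact absurd h1 (not_lt.2 h2)
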